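/- arXiv:1402.0969 — 5 statements merged into one kernel-verified Lean document; each statement's English description precedes it below -/
import Mathlib

section
/- Let H be a complex Hilbert space and M a von Neumann algebra on H (a star-subalgebra of the bounded operators on H equal to its double commutant). Let S and T be elements of M with 0 ≤ S ≤ T ≤ I in the operator (Loewner) order. Then there exists an element C of M with 0 ≤ C ≤ I such that T^{1/2} · C · T^{1/2} = S, where T^{1/2} denotes the positive square root of T given by the continuous functional calculus. -/
set_option synthInstance.maxHeartbeats 1000000
set_option maxHeartbeats 1000000

noncomputable section

/-- Douglas factorization for self-adjoint `B`. -/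
theorem douglas_aux
    {H : Type*} [NormedAddCommGroup H] [InnerProductSpace ℂ H] [CompleteSpace H]
    (A B : H →L[ℂ] H) (hB : IsSelfAdjoint B) (hAB : ∀ x, ‖A x‖ ≤ ‖B x‖) :
    ∃ D : H →L[ℂ] H, D * B = A ∧ (∀ x, ‖D x‖ ≤ ‖x‖) ∧
      ∀ y : H →L[ℂ] H, Commute A y → Commute B y → Commute D y := by
  let K : Submodule ℂ H := B.range.topologicalClosure
  have hKcl : IsClosed (K : Set H) := Submodule.isClosed_topologicalClosure _
  have : CompleteSpace K := hKcl.completeSpace_coe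
  have hmem : ∀ x, B x ∈ K := fun x =>
    Submodule.le_topologicalClosure _ (LinearMap.mem_range_self _ x)
  let e : H →ₗ[ℂ] K := (B : H →ₗ[ℂ] H).codRestrict K hmem
  have he : ∀ x, ((e x : K) : H) = B x := fun x => rfl
  have hdense : DenseRange e := by
    intro z
    rw [closure_subtype]
    have hz : (z : H) ∈ closure (Set.range B) := by
      have := z.2
      exact this
    refine closure_mono ?_ hz
    rintro _ ⟨x, rfl⟩
    exact ⟨e x, ⟨x, rfl⟩, rfl⟩
  have hnorm : ∀ x, ‖(A : H →ₗ[ℂ] H) x‖ ≤ 1 * ‖e x‖ := by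
    intro x
    rw [one_mul]
    exact hAB x
  let D₀ : K →L[ℂ] H := (A : H →ₗ[ℂ] H).extendOfNorm e
  have hD₀ : ∀ x, D₀ (e x) = A x := LinearMap.extendOfNorm_eq hdense ⟨1, hnorm⟩
  have hD₀n : ∀ z, ‖D₀ z‖ ≤ ‖z‖ := fun z => by
    simpa using LinearMap.norm_extendOfNorm_apply_le hdense 1 hnorm z
  let D : H →L[ℂ] H := D₀ ∘L K.orthogonalProjection
  have hDB : ∀ x, D (B x) = A x := by
    intro x
    have h1 : K.orthogonalProjection (B x) = e x :=
      Submodule.orthogonalProjection_mem_subspace_eq_self (e x)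
    change D₀ (K.orthogonalProjection (B x)) = A x
    rw [h1, hD₀]
  have hDker : ∀ v, B v = 0 → D v = 0 := by
    intro v hv
    have h1 : v ∈ Kᗮ := by
      change v ∈ (B.range.topologicalClosure)ᗮ
      rw [Submodule.orthogonal_closure, ContinuousLinearMap.orthogonal_range,
        ← ContinuousLinearMap.star_eq_adjoint, hB.star_eq]
      exact hv
    change D₀ (K.orthogonalProjection v) = 0
    rw [Submodule.orthogonalProjection_mem_subspace_orthogonalComplement_eq_zero h1, map_zero]
  have hker : ∀ v ∈ Kᗮ, B v = 0 := by
    intro v hv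
    change v ∈ (B.range.topologicalClosure)ᗮ at hv
    rw [Submodule.orthogonal_closure, ContinuousLinearMap.orthogonal_range,
        ← ContinuousLinearMap.star_eq_adjoint, hB.star_eq] at hv
    exact hv
  refine ⟨D, ContinuousLinearMap.ext hDB, fun x => ?_, fun y hA hBy => ?_⟩
  · exact (hD₀n _).trans (Submodule.norm_orthogonalProjection_apply_le K x)
  · have hAy : ∀ x, A (y x) = y (A x) := fun x => DFunLike.congr_fun hA.eq x
    have hBy' : ∀ x, B (y x) = y (B x) := fun x => DFunLike.congr_fun hBy.eq x
    have hK : ∀ z ∈ K, D (y z) = y (D z) := by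
      intro z hz
      have hz' : z ∈ closure (Set.range B) := hz
      have hc : IsClosed {z | D (y z) = y (D z)} := isClosed_eq (by fun_prop) (by fun_prop)
      refine closure_minimal ?_ hc hz'
      rintro _ ⟨x, rfl⟩
      change D (y (B x)) = y (D (B x))
      rw [← hBy', hDB, hDB, hAy]
    refine ContinuousLinearMap.ext fun x => ?_
    change D (y x) = y (D x)
    obtain ⟨u, hu, v, hv, rfl⟩ := K.exists_add_mem_mem_orthogonal x
    have hv0 := hker v hv
    have hyv : D (y v) = 0 := hDker _ (by rw [hBy', hv0, map_zero])
    simp only [map_add, hK u hu, hyv, hDker v hv0, map_zero]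

theorem norm_sqrt_apply_sq_aux
    {H : Type*} [NormedAddCommGroup H] [InnerProductSpace ℂ H] [CompleteSpace H]
    (T : H →L[ℂ] H) (hT : 0 ≤ T) (x : H) :
    ‖CFC.sqrt T x‖ ^ 2 = RCLike.re (inner ℂ (T x) x) := by
  have h1 := CFC.sqrt_mul_sqrt_self T hT
  have h2 := (ContinuousLinearMap.nonneg_iff_isPositive _).1 (CFC.sqrt_nonneg T)
  conv_rhs => rw [← h1]
  rw [ContinuousLinearMap.mul_apply, h2.inner_left_eq_inner_right,
    inner_self_eq_norm_sq]

/-- **Douglas-type factorization in a von Neumann algebra.**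
If `M` is a von Neumann algebra on a complex Hilbert space `H` and `S, T ∈ M`
satisfy `0 ≤ S ≤ T ≤ 1` in the Loewner order, then there is `C ∈ M` with
`0 ≤ C ≤ 1` and `T^{1/2} * C * T^{1/2} = S`, where `T^{1/2} = CFC.sqrt T` is the
positive square root of `T` given by the continuous functional calculus. -/
theorem exists_mem_vonNeumannAlgebra_sqrt_conj_eq
    {H : Type*} [NormedAddCommGroup H] [InnerProductSpace ℂ H] [CompleteSpace H]
    (M : VonNeumannAlgebra H) (S T : H →L[ℂ] H)
    (hSM : S ∈ M) (hTM : T ∈ M)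
    (hS : 0 ≤ S) (hST : S ≤ T) (hT : T ≤ 1) :
    ∃ C : H →L[ℂ] H, C ∈ M ∧ 0 ≤ C ∧ C ≤ 1 ∧
      CFC.sqrt T * C * CFC.sqrt T = S := by
  have hT0 : 0 ≤ T := hS.trans hST
  have hBsa : IsSelfAdjoint (CFC.sqrt T) := (CFC.sqrt_nonneg T).isSelfAdjoint
  have hAsa : IsSelfAdjoint (CFC.sqrt S) := (CFC.sqrt_nonneg S).isSelfAdjoint
  obtain ⟨D, hDB, hDn, hDc⟩ := douglas_aux (CFC.sqrt S) (CFC.sqrt T) hBsa (by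
    intro x
    refine (sq_le_sq₀ (norm_nonneg _) (norm_nonneg _)).1 ?_
    rw [norm_sqrt_apply_sq_aux S hS, norm_sqrt_apply_sq_aux T hT0]
    have h := ((ContinuousLinearMap.le_def S T).1 hST).re_inner_nonneg_left x
    rw [ContinuousLinearMap.sub_apply, inner_sub_left, map_sub] at h
    linarith)
  have hDM : D ∈ M := by
    rw [← M.commutant_commutant, VonNeumannAlgebra.mem_commutant_iff]
    intro y hy
    rw [VonNeumannAlgebra.mem_commutant_iff] at hy
    have hSy : Commute S y := hy S hSM
    have hTy : Commute T y := hy T hTM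
    exact (hDc y (hSy.cfcₙ_nnreal _) (hTy.cfcₙ_nnreal _)).eq.symm
  refine ⟨star D * D, mul_mem (star_mem hDM) hDM, star_mul_self_nonneg D, ?_, ?_⟩
  · have hn : ‖D‖ ≤ 1 := D.opNorm_le_bound zero_le_one (fun x => by simpa using hDn x)
    refine (CStarAlgebra.norm_le_one_iff_of_nonneg (star D * D) (star_mul_self_nonneg D)).1 ?_
    rw [CStarRing.norm_star_mul_self]
    exact mul_le_one₀ hn (norm_nonneg _) hn
  · calc CFC.sqrt T * (star D * D) * CFC.sqrt T
        = star (D * CFC.sqrt T) * (D * CFC.sqrt T) := by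
          rw [star_mul, hBsa.star_eq]; simp only [mul_assoc]
      _ = S := by rw [hDB, hAsa.star_eq, CFC.sqrt_mul_sqrt_self S hS]
end
end

section
/- Let Γ be a countable group acting on a countable set W with finitely many orbits, and let W' ⊆ W contain exactly one element of each orbit. Let μ₁ and μ₂ be Γ-invariant Borel probability measures on {0,1}^W. Suppose ν is a Γ-invariant monotone coupling of μ₁ and μ₂, i.e., a Borel probability measure on {0,1}^W × {0,1}^W with marginals μ₁ and μ₂, invariant under the diagonal action, and concentrated on {(ω₁, ω₂) : ω₁ ≤ ω₂ pointwise}. Then (i) Σ_{w ∈ W'} ν{(ω₁, ω₂) : ω₁(w) ≠ ω₂(w)} = Σ_{w ∈ W'} |μ₁{ω : ω(w) = 0} − μ₂{ω : ω(w) = 0}| (sums taken in [0,∞]), and (ii) for every Γ-invariant coupling ν' of μ₁ and μ₂ one has Σ_{w ∈ W'} ν'{(ω₁, ω₂) : ω₁(w) ≠ ω₂(w)} ≥ Σ_{w ∈ W'} ν{(ω₁, ω₂) : ω₁(w) ≠ ω₂(w)}. -/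
set_option synthInstance.maxHeartbeats 1000000
set_option maxHeartbeats 1000000

open MeasureTheory

noncomputable section

/-- The action of `Γ` on configurations `W → A` induced by an action of `Γ` on `W`:
`(g · ω)(w) = ω(g⁻¹ · w)`. -/
def shiftW (Γ : Type*) {W A : Type*} [Group Γ] [MulAction Γ W] (g : Γ) (ω : W → A) :
    W → A := fun w => ω (g⁻¹ • w)

theorem coupling_lower {W : Type*} (μ₁ μ₂ : Measure (W → Bool))
    (ν : Measure ((W → Bool) × (W → Bool)))
    (hfst : ν.map Prod.fst = μ₁) (hsnd : ν.map Prod.snd = μ₂) (w : W) :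
    max (μ₁ {ω | ω w = false} - μ₂ {ω | ω w = false})
      (μ₂ {ω | ω w = false} - μ₁ {ω | ω w = false}) ≤ ν {p | p.1 w ≠ p.2 w} := by
  have hm : MeasurableSet {ω : W → Bool | ω w = false} :=
    measurableSet_eq_fun (measurable_pi_apply w) measurable_const
  rw [← hfst, ← hsnd, Measure.map_apply measurable_fst hm, Measure.map_apply measurable_snd hm]
  refine max_le (le_measure_sdiff.trans (measure_mono ?_)) (le_measure_sdiff.trans (measure_mono ?_))
  · rintro p ⟨h1, h2⟩ h
    exact h2 (h.symm.trans h1)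
  · rintro p ⟨h1, h2⟩ h
    exact h2 (h.trans h1)

theorem coupling_upper {W : Type*} [Countable W] (μ₁ μ₂ : Measure (W → Bool))
    [IsProbabilityMeasure μ₁] (ν : Measure ((W → Bool) × (W → Bool)))
    (hfst : ν.map Prod.fst = μ₁) (hsnd : ν.map Prod.snd = μ₂)
    (hmono : ν {p | ∀ w : W, p.1 w ≤ p.2 w} = 1) (w : W) :
    ν {p | p.1 w ≠ p.2 w} ≤ max (μ₁ {ω | ω w = false} - μ₂ {ω | ω w = false})
      (μ₂ {ω | ω w = false} - μ₁ {ω | ω w = false}) := by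
  have hp : IsProbabilityMeasure ν := by
    constructor
    have h := measure_univ (μ := μ₁)
    rwa [← hfst, Measure.map_apply measurable_fst MeasurableSet.univ, Set.preimage_univ] at h
  have h1 (v : W) : Measurable fun p : (W → Bool) × (W → Bool) => p.1 v :=
    (measurable_pi_apply v).comp measurable_fst
  have h2 (v : W) : Measurable fun p : (W → Bool) × (W → Bool) => p.2 v :=
    (measurable_pi_apply v).comp measurable_snd
  have hmeas : MeasurableSet {p : (W → Bool) × (W → Bool) | ∀ w : W, p.1 w ≤ p.2 w} := by
    rw [Set.ofPred_forall]
    exact MeasurableSet.iInter fun v => ((h1 v).prodMk (h2 v))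
      (MeasurableSet.of_discrete (s := {q : Bool × Bool | q.1 ≤ q.2}))
  have hae : ∀ᵐ p ∂ν, ∀ w : W, p.1 w ≤ p.2 w := (prob_compl_eq_zero_iff hmeas).2 hmono
  have hm : MeasurableSet {ω : W → Bool | ω w = false} :=
    measurableSet_eq_fun (measurable_pi_apply w) measurable_const
  refine le_trans ?_ (le_max_left _ _)
  rw [← hfst, ← hsnd, Measure.map_apply measurable_fst hm, Measure.map_apply measurable_snd hm]
  have hB : MeasurableSet (Prod.snd ⁻¹' {ω : W → Bool | ω w = false} :
      Set ((W → Bool) × (W → Bool))) := measurable_snd hm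
  refine ENNReal.le_sub_of_add_le_right (measure_ne_top _ _) ?_
  have hsub : ({p | p.1 w ≠ p.2 w} : Set ((W → Bool) × (W → Bool))) ≤ᵐ[ν]
      (Prod.fst ⁻¹' {ω : W → Bool | ω w = false} \ Prod.snd ⁻¹' {ω : W → Bool | ω w = false} :
        Set ((W → Bool) × (W → Bool))) := by
    filter_upwards [hae] with p hp h
    have hw := hp w
    change p.1 w ≠ p.2 w at h
    change p.1 w = false ∧ ¬ p.2 w = false
    revert h hw
    cases p.1 w <;> cases p.2 w <;> simp
  have hsub2 : (Prod.snd ⁻¹' {ω : W → Bool | ω w = false} : Set ((W → Bool) × (W → Bool))) ≤ᵐ[ν]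
      (Prod.fst ⁻¹' {ω : W → Bool | ω w = false} ∩ Prod.snd ⁻¹' {ω : W → Bool | ω w = false} :
        Set ((W → Bool) × (W → Bool))) := by
    filter_upwards [hae] with p hp h
    have hw := hp w
    change p.2 w = false at h
    change p.1 w = false ∧ p.2 w = false
    revert h hw
    cases p.1 w <;> cases p.2 w <;> simp
  exact (add_le_add (measure_mono_ae hsub) (measure_mono_ae hsub2)).trans
    (measure_diff_add_inter _ hB).le

/-- **A monotone invariant coupling computes the d̄-distance.**
Let `Γ` act on `W` with `W'` a finite section meeting each orbit exactly once, let
`μ₁, μ₂` be `Γ`-invariant probability measures on `{0,1}^W`, and let `ν` be a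
`Γ`-invariant monotone coupling of `μ₁` and `μ₂`. Then (i) the coupling's total
disagreement over `W'` equals the sum of the absolute differences of the one-point
marginals, and (ii) `ν` minimizes total disagreement among all `Γ`-invariant couplings. -/
theorem monotone_coupling_dbar
    {Γ W : Type*} [Group Γ] [Countable Γ] [Countable W] [MulAction Γ W]
    (W' : Finset W)
    (hsec : ∀ w : W, ∃! w' : W, w' ∈ W' ∧ w' ∈ MulAction.orbit Γ w)
    (μ₁ μ₂ : Measure (W → Bool))
    [IsProbabilityMeasure μ₁] [IsProbabilityMeasure μ₂]
    (hinv₁ : ∀ g : Γ, μ₁.map (shiftW Γ g) = μ₁)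
    (hinv₂ : ∀ g : Γ, μ₂.map (shiftW Γ g) = μ₂)
    (ν : Measure ((W → Bool) × (W → Bool)))
    (hfst : ν.map Prod.fst = μ₁) (hsnd : ν.map Prod.snd = μ₂)
    (hinv : ∀ g : Γ, ν.map (fun p => (shiftW Γ g p.1, shiftW Γ g p.2)) = ν)
    (hmono : ν {p | ∀ w : W, p.1 w ≤ p.2 w} = 1) :
    (∑ w ∈ W', ν {p | p.1 w ≠ p.2 w}
        = ∑ w ∈ W', (max (μ₁ {ω | ω w = false} - μ₂ {ω | ω w = false})
            (μ₂ {ω | ω w = false} - μ₁ {ω | ω w = false}))) ∧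
    (∀ ν' : Measure ((W → Bool) × (W → Bool)),
      ν'.map Prod.fst = μ₁ → ν'.map Prod.snd = μ₂ →
      (∀ g : Γ, ν'.map (fun p => (shiftW Γ g p.1, shiftW Γ g p.2)) = ν') →
      ∑ w ∈ W', ν {p | p.1 w ≠ p.2 w} ≤ ∑ w ∈ W', ν' {p | p.1 w ≠ p.2 w}) := by
  have hU := coupling_upper μ₁ μ₂ ν hfst hsnd hmono
  refine ⟨Finset.sum_congr rfl fun w _ => le_antisymm (hU w)
    (coupling_lower μ₁ μ₂ ν hfst hsnd w), fun ν' h1 h2 _ => Finset.sum_le_sum fun w _ =>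
    (hU w).trans (coupling_lower μ₁ μ₂ ν' h1 h2 w)⟩
end
end

section
/- Let Γ be a countable group acting on a countable set W with finitely many orbits, and let W' ⊆ W contain exactly one element of each orbit. For Γ-invariant Borel probability measures μ, μ' on {0,1}^W define d̄(μ, μ') as the infimum, over all Γ-invariant couplings ν of μ and μ', of Σ_{w ∈ W'} ν{(ω₁, ω₂) : ω₁(w) ≠ ω₂(w)} (value in [0,∞]). Let μ₁, μ₂, μ₃, μ₄ be Γ-invariant probability measures on {0,1}^W, and suppose there exist Γ-invariant monotone couplings of (μ₁, μ₃), of (μ₃, μ₂), of (μ₁, μ₄), and of (μ₄, μ₂) (so μ₁ ≼ μ₃ ≼ μ₂ and μ₁ ≼ μ₄ ≼ μ₂ with invariant monotone witnesses). Then d̄(μ₃, μ₄) ≤ d̄(μ₁, μ₂). -/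
set_option synthInstance.maxHeartbeats 1000000
set_option maxHeartbeats 1000000

open MeasureTheory
open scoped ENNReal

noncomputable section

/-- Ornstein's d̄-distance between two `Γ`-invariant probability measures on `{0,1}^W`,
relative to a section `W'` of the orbits: the infimum, over all `Γ`-invariant couplings
`ν`, of `Σ_{w ∈ W'} ν{(ω₁, ω₂) : ω₁(w) ≠ ω₂(w)}` (in `[0,∞]`). -/
def dbar (Γ : Type*) {W : Type*} [Group Γ] [MulAction Γ W] (W' : Finset W)
    (μ₁ μ₂ : Measure (W → Bool)) : ℝ≥0∞ :=
  ⨅ ν : {ν : Measure ((W → Bool) × (W → Bool)) //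
      ν.map Prod.fst = μ₁ ∧ ν.map Prod.snd = μ₂ ∧
      ∀ g : Γ, ν.map (fun p => (shiftW Γ g p.1, shiftW Γ g p.2)) = ν},
    ∑ w ∈ W', (ν : Measure ((W → Bool) × (W → Bool))) {p | p.1 w ≠ p.2 w}

section glue
open ProbabilityTheory

variable {X : Type*} [MeasurableSpace X] [StandardBorelSpace X] [Nonempty X]

lemma glue_kernel_equiv (ν : Measure (X × X)) [IsFiniteMeasure ν] (T : X ≃ᵐ X)
    (hT : ν.map (fun p => (T p.1, T p.2)) = ν) :
    ∀ᵐ x ∂ν.fst, (ν.condKernel (T.symm x)).map T = ν.condKernel x := by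
  have hTm : Measurable (fun p : X × X => (T p.1, T p.2)) := by fun_prop
  have hμ : ν.fst.map T = ν.fst := by
    conv_rhs => rw [← hT]
    rw [Measure.fst, Measure.fst, Measure.map_map T.measurable measurable_fst,
      Measure.map_map measurable_fst hTm]
    rfl
  let κ : Kernel X X := (ν.condKernel.comap T.symm T.symm.measurable).map T
  have hκa : ∀ x, κ x = (ν.condKernel (T.symm x)).map T := by
    intro x
    simp only [κ]
    rw [Kernel.map_apply _ T.measurable, Kernel.comap_apply]
  have : IsMarkovKernel κ := Kernel.IsMarkovKernel.map _ T.measurable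
  have hκ : ν = ν.fst ⊗ₘ κ := by
    ext s hs
    rw [Measure.compProd_apply hs]
    conv_rhs => rw [← hμ]
    rw [lintegral_map (Kernel.measurable_kernel_prodMk_left hs) T.measurable]
    conv_lhs => rw [← hT, Measure.map_apply hTm hs, ← ν.disintegrate ν.condKernel,
      Measure.compProd_apply (hTm hs)]
    refine lintegral_congr fun x => ?_
    rw [hκa, Measure.map_apply T.measurable (measurable_prodMk_left hs)]
    simp only [MeasurableEquiv.symm_apply_apply]
    rfl
  have := eq_condKernel_of_measure_eq_compProd κ hκ
  filter_upwards [this] with x hx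
  rw [← hκa, hx]

lemma glue_exists (ν ν' : Measure (X × X)) [IsFiniteMeasure ν] [IsFiniteMeasure ν']
    (h : ν.fst = ν'.fst) {ι : Type*} (T : ι → X ≃ᵐ X)
    (hT : ∀ i, ν.map (fun p => (T i p.1, T i p.2)) = ν)
    (hT' : ∀ i, ν'.map (fun p => (T i p.1, T i p.2)) = ν') :
    ∃ ρ : Measure (X × X), ρ.map Prod.fst = ν.map Prod.snd ∧ ρ.map Prod.snd = ν'.map Prod.snd ∧
      (∀ i, ρ.map (fun p => (T i p.1, T i p.2)) = ρ) ∧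
      ∀ f : X → Bool, Measurable f →
        ρ {p | f p.1 ≠ f p.2} ≤ ν {p | f p.1 ≠ f p.2} + ν' {p | f p.1 ≠ f p.2} := by
  let η : Kernel X (X × X) := ν.condKernel ×ₖ ν'.condKernel
  have hη : ∀ x, η x = (ν.condKernel x).prod (ν'.condKernel x) := fun x => Kernel.prod_apply _ _ _
  let θ : Measure (X × (X × X)) := ν.fst ⊗ₘ η
  have h1 : θ.map (fun q => (q.1, q.2.1)) = ν := by
    conv_rhs => rw [← ν.disintegrate ν.condKernel]
    ext s hs
    rw [Measure.map_apply (by fun_prop) hs, Measure.compProd_apply hs,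
      Measure.compProd_apply ((by fun_prop : Measurable fun q : X × X × X => (q.1, q.2.1)) hs)]
    refine lintegral_congr fun x => ?_
    rw [hη]
    have : Prod.mk x ⁻¹' ((fun q : X × X × X => (q.1, q.2.1)) ⁻¹' s) =
      (Prod.mk x ⁻¹' s) ×ˢ Set.univ := by ext; simp
    rw [this, Measure.prod_prod]; simp
  have h2 : θ.map (fun q => (q.1, q.2.2)) = ν' := by
    conv_rhs => rw [← ν'.disintegrate ν'.condKernel, ← h]
    ext s hs
    rw [Measure.map_apply (by fun_prop) hs, Measure.compProd_apply hs,
      Measure.compProd_apply ((by fun_prop : Measurable fun q : X × X × X => (q.1, q.2.2)) hs)]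
    refine lintegral_congr fun x => ?_
    rw [hη]
    have : Prod.mk x ⁻¹' ((fun q : X × X × X => (q.1, q.2.2)) ⁻¹' s) =
      Set.univ ×ˢ (Prod.mk x ⁻¹' s) := by ext; simp
    rw [this, Measure.prod_prod]; simp
  refine ⟨θ.map Prod.snd, ?_, ?_, ?_, ?_⟩
  · conv_rhs => rw [← h1]
    rw [Measure.map_map (by fun_prop) (by fun_prop), Measure.map_map (by fun_prop) (by fun_prop)]
    rfl
  · conv_rhs => rw [← h2]
    rw [Measure.map_map (by fun_prop) (by fun_prop), Measure.map_map (by fun_prop) (by fun_prop)]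
    rfl
  · intro i
    have hTm : Measurable (fun p : X × X => (T i p.1, T i p.2)) := by fun_prop
    have hμ : ν.fst.map (T i) = ν.fst := by
      conv_rhs => rw [← hT i]
      rw [Measure.fst, Measure.fst, Measure.map_map (T i).measurable measurable_fst,
        Measure.map_map measurable_fst hTm]
      rfl
    have e1 := glue_kernel_equiv ν (T i) (hT i)
    have e2 := glue_kernel_equiv ν' (T i) (hT' i)
    rw [← h] at e2
    ext s hs
    rw [Measure.map_apply hTm hs, Measure.map_apply measurable_snd (hTm hs),
      Measure.map_apply measurable_snd hs,
      Measure.compProd_apply (measurable_snd (hTm hs)), Measure.compProd_apply (measurable_snd hs)]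
    change ∫⁻ x, η x ((fun p : X × X => (T i p.1, T i p.2)) ⁻¹' s) ∂ν.fst = ∫⁻ x, η x s ∂ν.fst
    have e3 : ∀ᵐ x ∂ν.fst,
        η x s = η ((T i).symm x) ((fun p : X × X => (T i p.1, T i p.2)) ⁻¹' s) := by
      filter_upwards [e1, e2] with x hx hx'
      rw [hη, hη, ← hx, ← hx', Measure.map_prod_map _ _ (T i).measurable (T i).measurable,
        Measure.map_apply (by fun_prop) hs]
      rfl
    rw [lintegral_congr_ae e3]
    conv_rhs => rw [← hμ]
    rw [lintegral_map_equiv]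
    simp
  · intro f hf
    have hm : MeasurableSet {p : X × X | f p.1 ≠ f p.2} :=
      (measurableSet_eq_fun (hf.comp measurable_fst) (hf.comp measurable_snd)).compl
    rw [Measure.map_apply measurable_snd hm]
    conv_rhs => rw [← h1, ← h2]
    rw [Measure.map_apply (by fun_prop) hm, Measure.map_apply (by fun_prop) hm]
    refine (measure_mono ?_).trans (measure_union_le _ _)
    intro q hq
    simp only [Set.mem_preimage, Set.mem_ofPred_eq, Set.mem_union] at hq ⊢
    by_contra hc
    push Not at hc
    exact hq (hc.1.symm.trans hc.2)

end glue

/-- The shift as a measurable equivalence. -/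
def shiftEquiv (Γ : Type*) {W : Type*} [Group Γ] [MulAction Γ W] (g : Γ) :
    (W → Bool) ≃ᵐ (W → Bool) where
  toFun := shiftW Γ g
  invFun := shiftW Γ g⁻¹
  left_inv := fun ω => by funext w; simp [shiftW]
  right_inv := fun ω => by funext w; simp [shiftW]
  measurable_toFun := measurable_pi_lambda _ fun w => measurable_pi_apply _
  measurable_invFun := measurable_pi_lambda _ fun w => measurable_pi_apply _

lemma mass_le {W : Type*} {ν : Measure ((W → Bool) × (W → Bool))} {μ μ' : Measure (W → Bool)}
    (h : ν.map Prod.fst = μ) (h' : ν.map Prod.snd = μ') (w : W) :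
    μ' {ω | ω w = true} ≤ μ {ω | ω w = true} + ν {p | p.1 w ≠ p.2 w} := by
  have hm : MeasurableSet {ω : W → Bool | ω w = true} :=
    measurableSet_eq_fun (measurable_pi_apply w) measurable_const
  rw [← h, ← h', Measure.map_apply measurable_fst hm, Measure.map_apply measurable_snd hm]
  refine (measure_mono ?_).trans (measure_union_le _ _)
  rintro ⟨x, y⟩ hq
  simp only [Set.mem_preimage, Set.mem_ofPred_eq, Set.mem_union] at hq ⊢
  by_cases hx : x w = true <;> simp_all

lemma mass_eq {W : Type*} [Countable W]
    {ν : Measure ((W → Bool) × (W → Bool))} {μ μ' : Measure (W → Bool)}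
    [IsProbabilityMeasure μ]
    (h : ν.map Prod.fst = μ) (h' : ν.map Prod.snd = μ')
    (hmon : ν {p | ∀ w : W, p.1 w ≤ p.2 w} = 1) (w : W) :
    μ {ω | ω w = true} + ν {p | p.1 w ≠ p.2 w} = μ' {ω | ω w = true} := by
  have hm : MeasurableSet {ω : W → Bool | ω w = true} :=
    measurableSet_eq_fun (measurable_pi_apply w) measurable_const
  have : IsProbabilityMeasure ν := by
    constructor
    have : (ν.map Prod.fst) Set.univ = 1 := by rw [h]; simp
    rwa [Measure.map_apply measurable_fst MeasurableSet.univ] at this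
  have hms : MeasurableSet {p : (W → Bool) × (W → Bool) | ∀ w : W, p.1 w ≤ p.2 w} := by
    rw [Set.ofPred_forall]
    refine MeasurableSet.iInter fun w => ?_
    have hpair : Measurable (fun p : (W → Bool) × (W → Bool) => (p.1 w, p.2 w)) :=
      ((measurable_pi_apply w).comp measurable_fst).prodMk
        ((measurable_pi_apply w).comp measurable_snd)
    exact hpair (Set.toFinite {q : Bool × Bool | q.1 ≤ q.2}).measurableSet
  have hae : ∀ᵐ p ∂ν, ∀ w : W, p.1 w ≤ p.2 w := (prob_compl_eq_zero_iff hms).2 hmon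
  have hne : MeasurableSet {p : (W → Bool) × (W → Bool) | p.1 w ≠ p.2 w} :=
    (measurableSet_eq_fun ((measurable_pi_apply w).comp measurable_fst)
      ((measurable_pi_apply w).comp measurable_snd)).compl
  refine le_antisymm ?_ (mass_le h h' w)
  rw [← h, ← h', Measure.map_apply measurable_fst hm, Measure.map_apply measurable_snd hm]
  have hd : AEDisjoint ν (Prod.fst ⁻¹' {ω : W → Bool | ω w = true})
      {p : (W → Bool) × (W → Bool) | p.1 w ≠ p.2 w} := by
    have : ∀ᵐ p ∂ν, ¬ (p ∈ (Prod.fst ⁻¹' {ω : W → Bool | ω w = true}) ∩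
      {p : (W → Bool) × (W → Bool) | p.1 w ≠ p.2 w}) := by
      filter_upwards [hae] with p hp
      have := hp w
      rintro ⟨h1, h2⟩
      simp only [Set.mem_preimage, Set.mem_ofPred_eq] at h1 h2
      revert this h1 h2
      cases p.1 w <;> cases p.2 w <;> simp
    exact measure_eq_zero_iff_ae_notMem.2 this
  rw [← measure_union₀ hne.nullMeasurableSet hd]
  refine measure_mono_ae ?_
  filter_upwards [hae] with p hp
  have := hp w
  intro hq
  change p.2 w = true
  change p.1 w = true ∨ p.1 w ≠ p.2 w at hq
  revert this hq
  cases p.1 w <;> cases p.2 w <;> simp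

/-- **Monotonicity of d̄ under stochastic sandwiching with invariant monotone witnesses.**
If `μ₁ ≼ μ₃ ≼ μ₂` and `μ₁ ≼ μ₄ ≼ μ₂` are witnessed by `Γ`-invariant monotone couplings,
then `d̄(μ₃, μ₄) ≤ d̄(μ₁, μ₂)`. -/
theorem dbar_le_dbar_of_sandwich
    {Γ W : Type*} [Group Γ] [Countable Γ] [Countable W] [MulAction Γ W]
    (W' : Finset W)
    (hsec : ∀ w : W, ∃! w' : W, w' ∈ W' ∧ w' ∈ MulAction.orbit Γ w)
    (μ₁ μ₂ μ₃ μ₄ : Measure (W → Bool))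
    [IsProbabilityMeasure μ₁] [IsProbabilityMeasure μ₂]
    [IsProbabilityMeasure μ₃] [IsProbabilityMeasure μ₄]
    (hinv₁ : ∀ g : Γ, μ₁.map (shiftW Γ g) = μ₁)
    (hinv₂ : ∀ g : Γ, μ₂.map (shiftW Γ g) = μ₂)
    (hinv₃ : ∀ g : Γ, μ₃.map (shiftW Γ g) = μ₃)
    (hinv₄ : ∀ g : Γ, μ₄.map (shiftW Γ g) = μ₄)
    (h13 : ∃ ν : Measure ((W → Bool) × (W → Bool)),
      ν.map Prod.fst = μ₁ ∧ ν.map Prod.snd = μ₃ ∧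
      (∀ g : Γ, ν.map (fun p => (shiftW Γ g p.1, shiftW Γ g p.2)) = ν) ∧
      ν {p | ∀ w : W, p.1 w ≤ p.2 w} = 1)
    (h32 : ∃ ν : Measure ((W → Bool) × (W → Bool)),
      ν.map Prod.fst = μ₃ ∧ ν.map Prod.snd = μ₂ ∧
      (∀ g : Γ, ν.map (fun p => (shiftW Γ g p.1, shiftW Γ g p.2)) = ν) ∧
      ν {p | ∀ w : W, p.1 w ≤ p.2 w} = 1)
    (h14 : ∃ ν : Measure ((W → Bool) × (W → Bool)),
      ν.map Prod.fst = μ₁ ∧ ν.map Prod.snd = μ₄ ∧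
      (∀ g : Γ, ν.map (fun p => (shiftW Γ g p.1, shiftW Γ g p.2)) = ν) ∧
      ν {p | ∀ w : W, p.1 w ≤ p.2 w} = 1)
    (h42 : ∃ ν : Measure ((W → Bool) × (W → Bool)),
      ν.map Prod.fst = μ₄ ∧ ν.map Prod.snd = μ₂ ∧
      (∀ g : Γ, ν.map (fun p => (shiftW Γ g p.1, shiftW Γ g p.2)) = ν) ∧
      ν {p | ∀ w : W, p.1 w ≤ p.2 w} = 1) :
    dbar Γ W' μ₃ μ₄ ≤ dbar Γ W' μ₁ μ₂ := by
  have fin : ∀ (ν : Measure ((W → Bool) × (W → Bool))) (μ : Measure (W → Bool))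
      [IsProbabilityMeasure μ], ν.map Prod.fst = μ → IsFiniteMeasure ν := by
    intro ν μ _ h
    constructor
    have : (ν.map Prod.fst) Set.univ = 1 := by rw [h]; simp
    rw [Measure.map_apply measurable_fst MeasurableSet.univ] at this
    rw [Set.preimage_univ] at this
    simp [this]
  obtain ⟨n13, a13, b13, i13, m13⟩ := h13
  obtain ⟨n32, a32, b32, i32, m32⟩ := h32
  obtain ⟨n14, a14, b14, i14, m14⟩ := h14
  obtain ⟨n42, a42, b42, i42, m42⟩ := h42
  have := fin _ _ a13
  have := fin _ _ a32
  have := fin _ _ a14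
  have := fin _ _ a42
  have := Measure.isFiniteMeasure_map n32 Prod.swap
  have := Measure.isFiniteMeasure_map n42 Prod.swap
  -- the swapped couplings
  have swapInv : ∀ ν : Measure ((W → Bool) × (W → Bool)),
      (∀ g : Γ, ν.map (fun p => (shiftW Γ g p.1, shiftW Γ g p.2)) = ν) →
      ∀ g : Γ, (ν.map Prod.swap).map (fun p => (shiftEquiv Γ g p.1, shiftEquiv Γ g p.2))
        = ν.map Prod.swap := by
    intro ν hν g
    have hTm : Measurable (fun p : (W → Bool) × (W → Bool) =>
      (shiftEquiv Γ g p.1, shiftEquiv Γ g p.2)) := by fun_prop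
    conv_rhs => rw [← hν g]
    rw [Measure.map_map hTm measurable_swap]
    erw [Measure.map_map measurable_swap hTm]
    rfl
  have swapCost : ∀ (ν : Measure ((W → Bool) × (W → Bool))) (w : W),
      (ν.map Prod.swap) {p | p.1 w ≠ p.2 w} = ν {p | p.1 w ≠ p.2 w} := by
    intro ν w
    have hne : MeasurableSet {p : (W → Bool) × (W → Bool) | p.1 w ≠ p.2 w} :=
      (measurableSet_eq_fun ((measurable_pi_apply w).comp measurable_fst)
        ((measurable_pi_apply w).comp measurable_snd)).compl
    rw [Measure.map_apply measurable_swap hne]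
    congr 1
    ext p
    exact ne_comm
  obtain ⟨ρ, r1, r2, r3, r4⟩ := glue_exists n13 n14 (a13.trans a14.symm)
    (fun g : Γ => shiftEquiv Γ g) i13 i14
  have fs : ∀ ν : Measure ((W → Bool) × (W → Bool)), (ν.map Prod.swap).map Prod.fst
      = ν.map Prod.snd := fun ν => by
    rw [Measure.map_map measurable_fst measurable_swap]; rfl
  have sf : ∀ ν : Measure ((W → Bool) × (W → Bool)), (ν.map Prod.swap).map Prod.snd
      = ν.map Prod.fst := fun ν => by
    rw [Measure.map_map measurable_snd measurable_swap]; rfl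
  obtain ⟨σ, s1, s2, s3, s4⟩ := glue_exists (n32.map Prod.swap) (n42.map Prod.swap)
    ((fs _).trans ((b32.trans b42.symm).trans (fs _).symm))
    (fun g : Γ => shiftEquiv Γ g) (swapInv _ i32) (swapInv _ i42)
  rw [sf] at s1 s2
  let C : Measure ((W → Bool) × (W → Bool)) → ℝ≥0∞ := fun ν => ∑ w ∈ W', ν {p | p.1 w ≠ p.2 w}
  let P : Measure (W → Bool) → ℝ≥0∞ := fun μ => ∑ w ∈ W', μ {ω | ω w = true}
  have hPf : ∀ (μ : Measure (W → Bool)) [IsProbabilityMeasure μ], P μ ≠ ∞ := fun μ _ =>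
    ENNReal.sum_ne_top.2 fun w _ => measure_ne_top _ _
  have hA : dbar Γ W' μ₃ μ₄ ≤ C n13 + C n14 := by
    refine (iInf_le _ ⟨ρ, r1.trans b13, r2.trans b14, r3⟩).trans ?_
    simp only [C]
    rw [← Finset.sum_add_distrib]
    exact Finset.sum_le_sum fun w _ => r4 (fun ω => ω w) (measurable_pi_apply w)
  have hB : dbar Γ W' μ₃ μ₄ ≤ C n32 + C n42 := by
    refine (iInf_le _ ⟨σ, s1.trans a32, s2.trans a42, s3⟩).trans ?_
    simp only [C]
    rw [← Finset.sum_add_distrib]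
    refine Finset.sum_le_sum fun w _ => ?_
    have := s4 (fun ω => ω w) (measurable_pi_apply w)
    rwa [swapCost, swapCost] at this
  have E : ∀ (ν : Measure ((W → Bool) × (W → Bool))) (μ μ' : Measure (W → Bool))
      [IsProbabilityMeasure μ], ν.map Prod.fst = μ → ν.map Prod.snd = μ' →
      ν {p | ∀ w : W, p.1 w ≤ p.2 w} = 1 → P μ + C ν = P μ' := by
    intro ν μ μ' _ h h' hm
    simp only [P, C]
    rw [← Finset.sum_add_distrib]
    exact Finset.sum_congr rfl fun w _ => mass_eq h h' hm w
  have e13 := E _ _ _ a13 b13 m13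
  have e32 := E _ _ _ a32 b32 m32
  have e14 := E _ _ _ a14 b14 m14
  have e42 := E _ _ _ a42 b42 m42
  refine le_iInf ?_
  rintro ⟨ν, n1, n2, -⟩
  change _ ≤ C ν
  have hD : P μ₂ ≤ P μ₁ + C ν := by
    simp only [P, C]
    rw [← Finset.sum_add_distrib]
    exact Finset.sum_le_sum fun w _ => mass_le n1 n2 w
  have k3 : C n13 + C n32 ≤ C ν := by
    rw [← e32, ← e13, add_assoc] at hD
    exact (ENNReal.add_le_add_iff_left (hPf μ₁)).1 hD
  have k4 : C n14 + C n42 ≤ C ν := by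
    rw [← e42, ← e14, add_assoc] at hD
    exact (ENNReal.add_le_add_iff_left (hPf μ₁)).1 hD
  by_contra hc
  push Not at hc
  have l1 := hc.trans_le hA
  have l2 := hc.trans_le hB
  have l3 := ENNReal.add_lt_add l1 l2
  have l4 := add_le_add k3 k4
  refine absurd l3 (not_lt.2 (le_trans (le_of_eq ?_) l4))
  ring
end
end

section
/- Let Γ be a countable group acting on a countable set W with finitely many orbits, and let W' ⊆ W contain exactly one element of each orbit. For Γ-invariant Borel probability measures μ, μ' on {0,1}^W define d̄(μ, μ') as the infimum, over all Γ-invariant couplings ν of μ and μ', of Σ_{w ∈ W'} ν{(ω₁, ω₂) : ω₁(w) ≠ ω₂(w)} (value in [0,∞]). Then d̄ satisfies the triangle inequality: for all Γ-invariant probability measures μ₁, μ₂, μ₃ on {0,1}^W, d̄(μ₁, μ₃) ≤ d̄(μ₁, μ₂) + d̄(μ₂, μ₃). -/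
set_option synthInstance.maxHeartbeats 1000000
set_option maxHeartbeats 1000000

open MeasureTheory
open scoped ENNReal

noncomputable section

open ProbabilityTheory

lemma measurable_shiftW_bool {Γ W : Type*} [Group Γ] [MulAction Γ W] (g : Γ) :
    Measurable (shiftW Γ g : (W → Bool) → (W → Bool)) :=
  measurable_pi_lambda _ fun w => measurable_pi_apply (g⁻¹ • w)

lemma shiftW_inv_shiftW_bool {Γ W : Type*} [Group Γ] [MulAction Γ W] (g : Γ) (ω : W → Bool) :
    shiftW Γ g⁻¹ (shiftW Γ g ω) = ω := by
  funext w
  simp [shiftW]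

/-- Pushing forward a composition-product along a product map. -/
lemma compProd_map_prodMap {X Y Z : Type*} [MeasurableSpace X] [MeasurableSpace Y]
    [MeasurableSpace Z]
    (μ : Measure X) [IsProbabilityMeasure μ] (κ : Kernel X Y) [IsMarkovKernel κ]
    (T T' : X → X) (hT : Measurable T) (hT' : Measurable T') (hTT : ∀ x, T' (T x) = x)
    (S : Y → Z) (hS : Measurable S) :
    (μ.compProd κ).map (fun p => (T p.1, S p.2)) =
      (μ.map T).compProd ((κ.comap T' hT').map S) := by
  have : IsProbabilityMeasure (μ.map T) := Measure.isProbabilityMeasure_map hT.aemeasurable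
  have : IsMarkovKernel ((κ.comap T' hT').map S) := Kernel.IsMarkovKernel.map _ hS
  have hm : Measurable (fun p : X × Y => (T p.1, S p.2)) := by fun_prop
  ext s hs
  rw [Measure.map_apply hm hs, Measure.compProd_apply (hm hs), Measure.compProd_apply hs,
    lintegral_map (Kernel.measurable_kernel_prodMk_left hs) hT]
  refine lintegral_congr fun x => ?_
  rw [Kernel.map_apply' _ hS _ (measurable_prodMk_left hs), Kernel.comap_apply, hTT]
  rfl

/-- An invariant measure has an a.e. equivariant disintegration. -/
lemma kernel_equivariant {X : Type*} [MeasurableSpace X] [StandardBorelSpace X]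
    (μ : Measure X) [IsProbabilityMeasure μ] (κ : Kernel X X) [IsMarkovKernel κ]
    (T T' : X → X) (hT : Measurable T) (hT' : Measurable T') (hTT : ∀ x, T' (T x) = x)
    (hμ : μ.map T = μ)
    (hinv : (μ.compProd κ).map (fun p => (T p.1, T p.2)) = μ.compProd κ) :
    (κ.comap T' hT').map T =ᵐ[μ] κ := by
  have : IsMarkovKernel ((κ.comap T' hT').map T) := Kernel.IsMarkovKernel.map _ hT
  rw [compProd_map_prodMap μ κ T T' hT hT' hTT T hT, hμ] at hinv
  exact Kernel.ae_eq_of_compProd_eq hinv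

lemma joining_invariant {X : Type*} [MeasurableSpace X] [StandardBorelSpace X]
    (μ : Measure X) [IsProbabilityMeasure μ] (κ η : Kernel X X) [IsMarkovKernel κ]
    [IsMarkovKernel η]
    (T T' : X → X) (hT : Measurable T) (hT' : Measurable T') (hTT : ∀ x, T' (T x) = x)
    (hμ : μ.map T = μ)
    (hκ : (μ.compProd κ).map (fun p => (T p.1, T p.2)) = μ.compProd κ)
    (hη : (μ.compProd η).map (fun p => (T p.1, T p.2)) = μ.compProd η) :
    (μ.compProd (κ.prod η)).map (fun p => (T p.1, (T p.2.1, T p.2.2))) =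
      μ.compProd (κ.prod η) := by
  have hS : Measurable (fun q : X × X => (T q.1, T q.2)) := by fun_prop
  have h := compProd_map_prodMap μ (κ.prod η) T T' hT hT' hTT (fun q => (T q.1, T q.2)) hS
  rw [hμ] at h
  refine h.trans (Measure.compProd_congr ?_)
  filter_upwards [kernel_equivariant μ κ T T' hT hT' hTT hμ hκ,
    kernel_equivariant μ η T T' hT hT' hTT hμ hη] with x h1 h2
  rw [Kernel.map_apply _ hT, Kernel.comap_apply] at h1 h2
  rw [Kernel.map_apply _ hS, Kernel.comap_apply, Kernel.prod_apply, Kernel.prod_apply,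
    ← h1, ← h2, Measure.map_prod_map _ _ hT hT]
  rfl

lemma compProd_prod_map_fst {X : Type*} [MeasurableSpace X]
    (μ : Measure X) [IsProbabilityMeasure μ] (κ η : Kernel X X) [IsMarkovKernel κ]
    [IsMarkovKernel η] :
    (μ.compProd (κ.prod η)).map (fun p => (p.1, p.2.1)) = μ.compProd κ := by
  have h := compProd_map_prodMap μ (κ.prod η) id id measurable_id measurable_id
    (fun _ => rfl) Prod.fst measurable_fst
  rw [Measure.map_id] at h
  refine h.trans ?_
  congr 1
  ext1 x
  rw [Kernel.map_apply _ measurable_fst, Kernel.comap_apply, Kernel.prod_apply]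
  simp

lemma compProd_prod_map_snd {X : Type*} [MeasurableSpace X]
    (μ : Measure X) [IsProbabilityMeasure μ] (κ η : Kernel X X) [IsMarkovKernel κ]
    [IsMarkovKernel η] :
    (μ.compProd (κ.prod η)).map (fun p => (p.1, p.2.2)) = μ.compProd η := by
  have h := compProd_map_prodMap μ (κ.prod η) id id measurable_id measurable_id
    (fun _ => rfl) Prod.snd measurable_snd
  rw [Measure.map_id] at h
  refine h.trans ?_
  congr 1
  ext1 x
  rw [Kernel.map_apply _ measurable_snd, Kernel.comap_apply, Kernel.prod_apply]
  simp

/-- **The d̄-distance satisfies the triangle inequality**, via the relatively independent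
joining of two invariant couplings over the common middle marginal. -/
theorem dbar_triangle
    {Γ W : Type*} [Group Γ] [Countable Γ] [Countable W] [MulAction Γ W]
    (W' : Finset W)
    (hsec : ∀ w : W, ∃! w' : W, w' ∈ W' ∧ w' ∈ MulAction.orbit Γ w)
    (μ₁ μ₂ μ₃ : Measure (W → Bool))
    [IsProbabilityMeasure μ₁] [IsProbabilityMeasure μ₂] [IsProbabilityMeasure μ₃]
    (hinv₁ : ∀ g : Γ, μ₁.map (shiftW Γ g) = μ₁)
    (hinv₂ : ∀ g : Γ, μ₂.map (shiftW Γ g) = μ₂)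
    (hinv₃ : ∀ g : Γ, μ₃.map (shiftW Γ g) = μ₃) :
    dbar Γ W' μ₁ μ₃ ≤ dbar Γ W' μ₁ μ₂ + dbar Γ W' μ₂ μ₃ := by
  unfold dbar
  rw [ENNReal.iInf_add]
  refine le_iInf fun ν => ?_
  rw [ENNReal.add_iInf]
  refine le_iInf fun ν' => ?_
  obtain ⟨ν, hν1, hν2, hνi⟩ := ν
  obtain ⟨ν', hν'1, hν'2, hν'i⟩ := ν'
  have hTm : ∀ g : Γ, Measurable (shiftW Γ g : (W → Bool) → (W → Bool)) :=
    measurable_shiftW_bool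
  -- the first coupling, flipped
  let ρ : Measure ((W → Bool) × (W → Bool)) := ν.map Prod.swap
  have hρ1 : ρ.fst = μ₂ := by
    rw [← hν2, Measure.fst, Measure.map_map measurable_fst measurable_swap]; rfl
  have hν'1' : ν'.fst = μ₂ := hν'1
  have hρp : IsProbabilityMeasure ρ := by
    constructor
    rw [← Measure.fst_univ, hρ1, measure_univ]
  have hν'p : IsProbabilityMeasure ν' := by
    constructor
    rw [← Measure.fst_univ, hν'1', measure_univ]
  have hρd : μ₂.compProd ρ.condKernel = ρ := by
    have := ρ.disintegrate ρ.condKernel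
    rwa [hρ1] at this
  have hν'd : μ₂.compProd ν'.condKernel = ν' := by
    have := ν'.disintegrate ν'.condKernel
    rwa [hν'1'] at this
  have hρi : ∀ g : Γ, ρ.map (fun p => (shiftW Γ g p.1, shiftW Γ g p.2)) = ρ := by
    intro g
    have hg := hTm g
    have hgg : Measurable (fun p : (W → Bool) × (W → Bool) =>
      (shiftW Γ g p.1, shiftW Γ g p.2)) := by fun_prop
    conv_rhs => rw [show ρ = ν.map Prod.swap from rfl, ← hνi g]
    rw [Measure.map_map hgg measurable_swap, Measure.map_map measurable_swap hgg]
    rfl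
  let L := μ₂.compProd (ρ.condKernel.prod ν'.condKernel)
  have hLκ : L.map (fun p => (p.1, p.2.1)) = ρ :=
    (compProd_prod_map_fst μ₂ _ _).trans hρd
  have hLη : L.map (fun p => (p.1, p.2.2)) = ν' :=
    (compProd_prod_map_snd μ₂ _ _).trans hν'd
  have hLi : ∀ g : Γ, L.map (fun p => (shiftW Γ g p.1, (shiftW Γ g p.2.1, shiftW Γ g p.2.2))) = L :=
    fun g => joining_invariant μ₂ _ _ (shiftW Γ g) (shiftW Γ g⁻¹) (hTm g) (hTm _)
      (shiftW_inv_shiftW_bool g) (hinv₂ g) (by rw [hρd]; exact hρi g) (by rw [hν'd]; exact hν'i g)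
  have hm1 : Measurable (fun p : (W → Bool) × (W → Bool) × (W → Bool) => (p.1, p.2.1)) := by
    fun_prop
  have hm2 : Measurable (fun p : (W → Bool) × (W → Bool) × (W → Bool) => (p.1, p.2.2)) := by
    fun_prop
  have hset : ∀ w : W, MeasurableSet {p : (W → Bool) × (W → Bool) | p.1 w ≠ p.2 w} := by
    intro w
    have h1 : Measurable (fun p : (W → Bool) × (W → Bool) => p.1 w) := by fun_prop
    have h2 : Measurable (fun p : (W → Bool) × (W → Bool) => p.2 w) := by fun_prop
    exact (measurableSet_eq_fun h1 h2).compl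
  refine (iInf_le _ ⟨L.map Prod.snd, ?_, ?_, ?_⟩).trans ?_
  rotate_left
  · rw [Measure.map_map measurable_fst measurable_snd, ← hν1,
      show ν.map Prod.fst = ρ.map Prod.snd from
        (Measure.map_map measurable_snd measurable_swap).symm, ← hLκ,
      Measure.map_map measurable_snd hm1]
    rfl
  · rw [Measure.map_map measurable_snd measurable_snd, ← hν'2]
    conv_rhs => rw [← hLη, Measure.map_map measurable_snd hm2]
    rfl
  · intro g
    have hg := hTm g
    have hgg : Measurable (fun p : (W → Bool) × (W → Bool) =>
      (shiftW Γ g p.1, shiftW Γ g p.2)) := by fun_prop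
    have hggg : Measurable (fun p : (W → Bool) × (W → Bool) × (W → Bool) =>
      (shiftW Γ g p.1, (shiftW Γ g p.2.1, shiftW Γ g p.2.2))) := by fun_prop
    conv_rhs => rw [← hLi g]
    rw [Measure.map_map hgg measurable_snd, Measure.map_map measurable_snd hggg]
    rfl
  · rw [← Finset.sum_add_distrib]
    refine Finset.sum_le_sum fun w _ => ?_
    have e1 : ν {p | p.1 w ≠ p.2 w} = L {p | p.1 w ≠ p.2.1 w} := by
      have a : ρ {p | p.1 w ≠ p.2 w} = ν {p | p.1 w ≠ p.2 w} := by
        rw [show ρ = ν.map Prod.swap from rfl, Measure.map_apply measurable_swap (hset w)]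
        congr 1
        ext p
        exact ne_comm
      rw [← a, ← hLκ, Measure.map_apply hm1 (hset w)]
      rfl
    have e2 : ν' {p | p.1 w ≠ p.2 w} = L {p | p.1 w ≠ p.2.2 w} := by
      conv_lhs => rw [← hLη, Measure.map_apply hm2 (hset w)]
      rfl
    change (L.map Prod.snd) {p | p.1 w ≠ p.2 w} ≤ ν {p | p.1 w ≠ p.2 w} + ν' {p | p.1 w ≠ p.2 w}
    rw [e1, e2, Measure.map_apply measurable_snd (hset w)]
    refine (measure_mono ?_).trans (measure_union_le _ _)
    intro p hp
    by_contra hc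
    simp only [Set.mem_union, Set.mem_setOf_eq, not_or, not_not] at hc
    exact hp (hc.1.symm.trans hc.2)
end
end

section
/- Let A be a unital C*-algebra and let q, q' ∈ A satisfy 0 ≤ q ≤ 1 and 0 ≤ q' ≤ 1. Set r := ‖q − q'‖ and t := r / (1 + 2r), and define q_t := (1 − t)q + t(1 − q) and q'_t := (1 − t)q' + t(1 − q'). Then: (i) t·1 ≤ q'_t ≤ (1 − t)·1; (ii) ‖q_t − q'_t‖ = (1 − 2t)·r = t; and (iii) the chain of inequalities 0 ≤ q'_t − t·1 ≤ q_t ≤ q'_t + t·1 ≤ 1 holds in the order of self-adjoint elements of A. -/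
set_option synthInstance.maxHeartbeats 1000000
set_option maxHeartbeats 1000000

noncomputable section

/-- **The key operator inequalities in the norm bound for the d̄-distance.**
Let `A` be a unital C*-algebra (with its canonical order, in which `a ≤ b` iff `b − a`
is a nonnegative element) and let `0 ≤ q ≤ 1`, `0 ≤ q' ≤ 1`. With `r = ‖q − q'‖`,
`t = r/(1 + 2r)`, `q_t = (1−t)q + t(1−q)` and `q'_t = (1−t)q' + t(1−q')`, we have
(i) `t·1 ≤ q'_t ≤ (1−t)·1`; (ii) `‖q_t − q'_t‖ = (1−2t)r = t`; and
(iii) `0 ≤ q'_t − t·1 ≤ q_t ≤ q'_t + t·1 ≤ 1`. -/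
theorem cstar_interpolation_inequalities
    {A : Type*} [CStarAlgebra A] [PartialOrder A] [StarOrderedRing A]
    (q q' : A) (hq0 : 0 ≤ q) (hq1 : q ≤ 1) (hq'0 : 0 ≤ q') (hq'1 : q' ≤ 1) :
    letI r : ℝ := ‖q - q'‖
    letI t : ℝ := r / (1 + 2 * r)
    letI qt : A := (1 - t) • q + t • (1 - q)
    letI q't : A := (1 - t) • q' + t • (1 - q')
    (t • (1 : A) ≤ q't ∧ q't ≤ (1 - t) • (1 : A)) ∧
    (‖qt - q't‖ = (1 - 2 * t) * r ∧ (1 - 2 * t) * r = t) ∧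
    (0 ≤ q't - t • (1 : A) ∧ q't - t • (1 : A) ≤ qt ∧
      qt ≤ q't + t • (1 : A) ∧ q't + t • (1 : A) ≤ 1) := by
  set r : ℝ := ‖q - q'‖
  set t : ℝ := r / (1 + 2 * r)
  set qt : A := (1 - t) • q + t • (1 - q)
  set q't : A := (1 - t) • q' + t • (1 - q')
  have hr : 0 ≤ r := norm_nonneg _
  have hpos : 0 < 1 + 2 * r := by linarith
  have ht : 0 ≤ t := div_nonneg hr hpos.le
  have hs : 1 - 2 * t = 1 / (1 + 2 * r) := by
    simp only [t]; field_simp; ring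
  have hs0 : 0 ≤ 1 - 2 * t := by rw [hs]; positivity
  have hst : (1 - 2 * t) * r = t := by rw [hs]; simp only [t]; field_simp
  have hsa : IsSelfAdjoint (q - q') :=
    (IsSelfAdjoint.of_nonneg hq0).sub (IsSelfAdjoint.of_nonneg hq'0)
  have h1 : q - q' ≤ r • (1 : A) := by
    have := hsa.le_algebraMap_norm_self
    rwa [Algebra.algebraMap_eq_smul_one] at this
  have h2 : -(r • (1 : A)) ≤ q - q' := by
    have := hsa.neg_algebraMap_norm_le_self
    rwa [Algebra.algebraMap_eq_smul_one] at this
  have hd : qt - q't = (1 - 2 * t) • (q - q') := by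
    simp only [qt, q't]; module
  have e1 : q't - t • (1 : A) = (1 - 2 * t) • q' := by
    simp only [q't]; module
  have e2 : (1 - t) • (1 : A) - q't = (1 - 2 * t) • (1 - q') := by
    simp only [q't]; module
  have e3 : (1 : A) - (q't + t • (1 : A)) = (1 - 2 * t) • (1 - q') := by
    simp only [q't]; module
  have p1 : 0 ≤ (1 - 2 * t) • q' := smul_nonneg hs0 hq'0
  have p2 : 0 ≤ (1 - 2 * t) • (1 - q') := smul_nonneg hs0 (sub_nonneg.2 hq'1)
  have e4 : qt - (q't - t • (1 : A)) = (1 - 2 * t) • (q - q' - -(r • (1 : A))) := by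
    have : qt - (q't - t • (1 : A)) = (qt - q't) + t • (1 : A) := by abel
    rw [this, hd, sub_neg_eq_add, smul_add, smul_smul, hst]
  have e5 : q't + t • (1 : A) - qt = (1 - 2 * t) • (r • (1 : A) - (q - q')) := by
    have : q't + t • (1 : A) - qt = t • (1 : A) - (qt - q't) := by abel
    rw [this, hd, smul_sub _ (r • (1 : A)), smul_smul, hst]
  refine ⟨⟨?_, ?_⟩, ⟨?_, hst⟩, ?_, ?_, ?_, ?_⟩
  · rw [← sub_nonneg, e1]; exact p1
  · rw [← sub_nonneg, e2]; exact p2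
  · rw [hd, norm_smul, Real.norm_of_nonneg hs0]
  · rw [e1]; exact p1
  · rw [← sub_nonneg, e4]; exact smul_nonneg hs0 (sub_nonneg.2 h2)
  · rw [← sub_nonneg, e5]; exact smul_nonneg hs0 (sub_nonneg.2 h1)
  · rw [← sub_nonneg, e3]; exact p2
end
end
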